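/- Let F be a nonempty subset of P_2(ℝ) that is displacement convex and closed with respect to W_2, and let μ ∈ P_2(ℝ). Then μ̂ ∈ F is the unique minimizer of ν ↦ W_2(ν, μ) over F if and only if ∫_0^1 (Q_μ̂(u) − Q_μ(u))(Q_ν(u) − Q_μ̂(u)) du ≥ 0 for every ν ∈ F. -/

import Mathlib

open MeasureTheory Set Filter

noncomputable def quantile (μ : MeasureTheory.Measure ℝ) (u : ℝ) : ℝ :=
  sInf {x : ℝ | u ≤ (μ (Set.Iic x)).toReal}

def HasFiniteMomentP (p : ℝ) (μ : MeasureTheory.Measure ℝ) : Prop :=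
  MeasureTheory.IsProbabilityMeasure μ ∧
    MeasureTheory.Integrable (fun x => |x| ^ p) μ

noncomputable def Wdist (p : ℝ) (μ ν : MeasureTheory.Measure ℝ) : ℝ :=
  (∫ u in Set.Ioo (0:ℝ) 1, |quantile μ u - quantile ν u| ^ p) ^ (1 / p)

def DisplacementConvex (F : Set (MeasureTheory.Measure ℝ)) : Prop :=
  ∀ μ ∈ F, ∀ ν ∈ F, ∀ t ∈ Set.Icc (0:ℝ) 1, ∃ σ ∈ F,
    ∀ u ∈ Set.Ioo (0:ℝ) 1,
      quantile σ u = (1 - t) * quantile μ u + t * quantile ν u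

def WClosed (p : ℝ) (F : Set (MeasureTheory.Measure ℝ)) : Prop :=
  ∀ (μs : ℕ → MeasureTheory.Measure ℝ) (μ : MeasureTheory.Measure ℝ),
    (∀ n, μs n ∈ F) → HasFiniteMomentP p μ →
    Filter.Tendsto (fun n => Wdist p (μs n) μ) Filter.atTop (nhds 0) → μ ∈ F

open ProbabilityTheory Topology

lemma quantile_le_iff (μ : Measure ℝ) [IsProbabilityMeasure μ] {u : ℝ} (hu : u ∈ Ioo (0:ℝ) 1)
    (x : ℝ) : quantile μ u ≤ x ↔ u ≤ cdf μ x := by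
  have hq : quantile μ u = sInf {x : ℝ | u ≤ cdf μ x} := by
    simp only [quantile, cdf_eq_real, Measure.real]
  have hbdd : BddBelow {x : ℝ | u ≤ cdf μ x} := by
    obtain ⟨a, ha⟩ := ((tendsto_cdf_atBot μ).eventually_lt_const hu.1).exists
    exact ⟨a, fun y hy => le_of_not_gt fun h =>
      absurd ((hy.trans (monotone_cdf μ h.le)).trans_lt ha) (lt_irrefl u)⟩
  have hnonempty : {x : ℝ | u ≤ cdf μ x}.Nonempty := by
    obtain ⟨a, ha⟩ := ((tendsto_cdf_atTop μ).eventually_const_lt hu.2).exists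
    exact ⟨a, ha.le⟩
  rw [hq]
  refine ⟨fun h => ?_, fun h => csInf_le hbdd h⟩
  have hright : Tendsto (cdf μ) (𝓝[>] x) (𝓝 (cdf μ x)) :=
    ((cdf μ).right_continuous x).tendsto.mono_left (nhdsWithin_mono _ Ioi_subset_Ici_self)
  refine ge_of_tendsto hright ?_
  filter_upwards [self_mem_nhdsWithin] with y hy
  obtain ⟨s, hs, hsy⟩ := exists_lt_of_csInf_lt hnonempty (h.trans_lt hy)
  exact hs.trans (monotone_cdf μ hsy.le)

lemma monotoneOn_quantile (μ : Measure ℝ) [IsProbabilityMeasure μ] :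
    MonotoneOn (quantile μ) (Ioo (0:ℝ) 1) := fun _ hu _ hv huv =>
  (quantile_le_iff μ hu _).2 (huv.trans ((quantile_le_iff μ hv _).1 le_rfl))

lemma aemeasurable_quantile (μ : Measure ℝ) [IsProbabilityMeasure μ] :
    AEMeasurable (quantile μ) (volume.restrict (Ioo (0:ℝ) 1)) :=
  aemeasurable_restrict_of_monotoneOn measurableSet_Ioo (monotoneOn_quantile μ)

lemma map_quantile (μ : Measure ℝ) [IsProbabilityMeasure μ] :
    (volume.restrict (Ioo (0:ℝ) 1)).map (quantile μ) = μ := by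
  have hmeas := aemeasurable_quantile μ
  have : IsFiniteMeasure ((volume.restrict (Ioo (0:ℝ) 1)).map (quantile μ)) :=
    Measure.isFiniteMeasure_map _ _
  refine Measure.ext_of_Iic _ _ fun x => ?_
  rw [Measure.map_apply_of_aemeasurable hmeas measurableSet_Iic,
    Measure.restrict_apply' measurableSet_Ioo, ← ofReal_cdf]
  apply le_antisymm
  · calc _ ≤ volume (Ioc 0 (cdf μ x)) :=
          measure_mono fun u hu => ⟨hu.2.1, (quantile_le_iff μ hu.2 x).1 hu.1⟩
      _ = _ := by simp
  · calc _ = volume (Ioo 0 (cdf μ x)) := by simp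
      _ ≤ _ := measure_mono fun u hu =>
          have hu' : u ∈ Ioo (0:ℝ) 1 := And.intro hu.1 (hu.2.trans_le (cdf_le_one μ x))
          And.intro ((quantile_le_iff μ hu' x).2 hu.2.le) hu'

lemma HasFiniteMomentP.memLp_quantile {μ : Measure ℝ} (hμ : HasFiniteMomentP 2 μ) :
    MemLp (quantile μ) 2 (volume.restrict (Ioo (0:ℝ) 1)) := by
  obtain ⟨hprob, hint⟩ := hμ
  have hid : MemLp id 2 μ := by
    rw [memLp_two_iff_integrable_sq aestronglyMeasurable_id]
    simpa using hint
  rw [← map_quantile μ] at hid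
  exact hid.comp_of_map (aemeasurable_quantile μ)

lemma Wdist_two_le_iff (μ ν ρ : Measure ℝ) :
    Wdist 2 μ ρ ≤ Wdist 2 ν ρ ↔
      ∫ u in Ioo (0:ℝ) 1, (quantile μ u - quantile ρ u) ^ 2 ≤
        ∫ u in Ioo (0:ℝ) 1, (quantile ν u - quantile ρ u) ^ 2 := by
  simp only [Wdist, Real.rpow_two, sq_abs]
  exact Real.rpow_le_rpow_iff (integral_nonneg fun _ => sq_nonneg _)
    (integral_nonneg fun _ => sq_nonneg _) (by norm_num)

lemma integral_add_mul_sq {α : Type*} [MeasurableSpace α] {m : Measure α} {f g : α → ℝ}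
    (hf : MemLp f 2 m) (hg : MemLp g 2 m) (t : ℝ) :
    ∫ a, (f a + t * g a) ^ 2 ∂m =
      ∫ a, f a ^ 2 ∂m + 2 * t * ∫ a, f a * g a ∂m + t ^ 2 * ∫ a, g a ^ 2 ∂m := by
  have hfg : Integrable (fun a => f a * g a) m := hf.integrable_mul hg
  have hsum : Integrable (fun a => f a ^ 2 + 2 * t * (f a * g a)) m :=
    hf.integrable_sq.add (hfg.const_mul _)
  rw [← integral_const_mul, ← integral_const_mul,
    ← integral_add hf.integrable_sq (hfg.const_mul _),
    ← integral_add hsum (hg.integrable_sq.const_mul _)]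
  refine integral_congr_ae (ae_of_all _ fun a => ?_)
  ring

/-- Corollary 2.9, first-order condition for `p = 2`.
Let `F ⊆ P_2(ℝ)` be nonempty, displacement convex and `W_2`-closed, and `μ ∈ P_2(ℝ)`.
Then `μhat ∈ F` is the (unique) minimizer of `ν ↦ W_2(ν, μ)` over `F` if and only if
`∫_0^1 (Q_μhat(u) − Q_μ(u)) (Q_ν(u) − Q_μhat(u)) du ≥ 0` for every `ν ∈ F`. -/
theorem wasserstein_projection_first_order_condition
    (F : Set (MeasureTheory.Measure ℝ)) (hne : F.Nonempty)
    (hFmom : ∀ ρ ∈ F, HasFiniteMomentP 2 ρ)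
    (hconv : DisplacementConvex F)
    (hclosed : WClosed 2 F)
    (μ : MeasureTheory.Measure ℝ) (hμ : HasFiniteMomentP 2 μ)
    (μhat : MeasureTheory.Measure ℝ) (hμhatF : μhat ∈ F) :
    (∀ ν ∈ F, Wdist 2 μhat μ ≤ Wdist 2 ν μ) ↔
      (∀ ν ∈ F,
        0 ≤ ∫ u in Set.Ioo (0:ℝ) 1,
          (quantile μhat u - quantile μ u) * (quantile ν u - quantile μhat u)) := by
  have hν_sq (ν : Measure ℝ) (hν : ν ∈ F) := integral_add_mul_sq
    ((hFmom μhat hμhatF).memLp_quantile.sub hμ.memLp_quantile)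
    ((hFmom ν hν).memLp_quantile.sub (hFmom μhat hμhatF).memLp_quantile)
  simp only [Pi.sub_apply] at hν_sq
  simp only [Wdist_two_le_iff]
  constructor
  · intro hmin ν hν
    have hexp := hν_sq ν hν
    have hC : 0 ≤ ∫ u in Ioo (0:ℝ) 1, (quantile ν u - quantile μhat u) ^ 2 :=
      integral_nonneg fun _ => sq_nonneg _
    set B := ∫ u in Ioo (0:ℝ) 1,
      (quantile μhat u - quantile μ u) * (quantile ν u - quantile μhat u)
    set C := ∫ u in Ioo (0:ℝ) 1, (quantile ν u - quantile μhat u) ^ 2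
    have hquad (t : ℝ) (ht : t ∈ Icc (0:ℝ) 1) : 0 ≤ t * (2 * B + t * C) := by
      obtain ⟨σ, hσ, hσq⟩ := hconv μhat hμhatF ν hν t ht
      have hcongr : ∫ u in Ioo (0:ℝ) 1, (quantile σ u - quantile μ u) ^ 2 =
          ∫ u in Ioo (0:ℝ) 1, (quantile μhat u - quantile μ u +
            t * (quantile ν u - quantile μhat u)) ^ 2 := by
        refine setIntegral_congr_fun measurableSet_Ioo fun u hu => ?_
        simp only [hσq u hu]
        ring
      have hle := hmin σ hσ
      rw [hcongr, hexp t] at hle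
      linarith
    by_contra! hB
    have hD : 0 < C - B := by linarith
    have ht : 0 < -B / (C - B) := div_pos (by linarith) hD
    have ht1 : -B / (C - B) ≤ 1 := (div_le_one hD).2 (by linarith)
    have htC : -B / (C - B) * C ≤ -B := by
      rw [div_mul_eq_mul_div, div_le_iff₀ hD]
      nlinarith
    nlinarith [hquad _ ⟨ht.le, ht1⟩]
  · intro hfirst ν hν
    have hexp := hν_sq ν hν 1
    have hC : 0 ≤ ∫ u in Ioo (0:ℝ) 1, (quantile ν u - quantile μhat u) ^ 2 :=
      integral_nonneg fun _ => sq_nonneg _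
    have hB := hfirst ν hν
    simp only [one_mul, one_pow, mul_one, sub_add_sub_cancel'] at hexp
    linarith
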